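/- For every Pe > 0, Pe·coth(Pe) − 1 ≥ 14·(4·Pe⁴ + 90·Pe²)/(4·Pe⁴ + 420·Pe² + 3780). Equivalently, the numerical diffusivity of the condensed quintic (p = 5) finite element scheme, Γ̄₅ = 14·Γ·(4·Pe⁴ + 90·Pe²)/(4·Pe⁴ + 420·Pe² + 3780), never exceeds the nodally exact artificial diffusivity Γ̄ = Γ·(Pe·coth(Pe) − 1). -/

import Mathlib

/-- A function vanishing at `0` whose derivative is `x * g x`, with `g` nonnegative on `[0, ∞)`,
is nonnegative on `[0, ∞)`. -/
theorem nonneg_of_hasDerivAt_mul {f g : ℝ → ℝ} (h0 : f 0 = 0)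
    (hf : ∀ x, HasDerivAt f (x * g x) x) (hg : ∀ x, 0 ≤ x → 0 ≤ g x) {x : ℝ} (hx : 0 ≤ x) :
    0 ≤ f x := by
  have hmono : MonotoneOn f (Set.Ici 0) := by
    refine monotoneOn_of_hasDerivWithinAt_nonneg (convex_Ici 0)
      (fun y _ => (hf y).continuousAt.continuousWithinAt)
      (fun y _ => (hf y).hasDerivWithinAt) fun y hy => ?_
    have hy0 : 0 ≤ y := interior_subset hy
    exact mul_nonneg hy0 (hg y hy0)
  exact h0 ▸ hmono Set.self_mem_Ici hx hx

/-- If `p` vanishes at `0` and the derivative of `p * cosh - q * sinh` is `x * g x` with `g`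
nonnegative on `[0, ∞)`, then `p * cosh - q * sinh` is nonnegative on `[0, ∞)`. -/
theorem Polynomial.eval_mul_cosh_sub_eval_mul_sinh_nonneg (p q : Polynomial ℝ) {g : ℝ → ℝ}
    (hp : p.eval 0 = 0)
    (hd : ∀ x, (p.derivative.eval x - q.eval x) * Real.cosh x +
      (p.eval x - q.derivative.eval x) * Real.sinh x = x * g x)
    (hg : ∀ x, 0 ≤ x → 0 ≤ g x) {x : ℝ} (hx : 0 ≤ x) :
    0 ≤ p.eval x * Real.cosh x - q.eval x * Real.sinh x := by
  refine nonneg_of_hasDerivAt_mul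
    (f := fun y => p.eval y * Real.cosh y - q.eval y * Real.sinh y) (by simp [hp])
    (fun y => ?_) hg hx
  rw [← hd y]
  exact (((p.hasDerivAt y).mul (Real.hasDerivAt_cosh y)).sub
    ((q.hasDerivAt y).mul (Real.hasDerivAt_sinh y))).congr_deriv (by ring)

section

open Polynomial

theorem sinh_le_mul_cosh {x : ℝ} (hx : 0 ≤ x) :
    Real.sinh x ≤ x * Real.cosh x := by
  have h := eval_mul_cosh_sub_eval_mul_sinh_nonneg X 1
    (g := Real.sinh)
    (by simp) (fun y => by simp) (fun y hy => Real.sinh_nonneg_iff.2 hy) hx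
  simp at h
  linarith

theorem three_mul_mul_cosh_le {x : ℝ} (hx : 0 ≤ x) :
    3 * x * Real.cosh x ≤
      (x ^ 2 + 3) * Real.sinh x := by
  have h := eval_mul_cosh_sub_eval_mul_sinh_nonneg (-(3 * X)) (-(X ^ 2 + 3))
    (g := fun y => y * Real.cosh y -
      Real.sinh y)
    (by simp) (fun y => by simp; ring) (fun y hy => sub_nonneg.2 (sinh_le_mul_cosh hy)) hx
  simp at h
  linarith

theorem six_mul_sq_add_mul_sinh_le {x : ℝ} (hx : 0 ≤ x) :
    (6 * x ^ 2 + 15) * Real.sinh x ≤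
      (x ^ 3 + 15 * x) * Real.cosh x := by
  have h := eval_mul_cosh_sub_eval_mul_sinh_nonneg (X ^ 3 + 15 * X) (6 * X ^ 2 + 15)
    (g := fun y => (y ^ 2 + 3) * Real.sinh y -
      3 * y * Real.cosh y)
    (by simp) (fun y => by simp; ring) (fun y hy => sub_nonneg.2 (three_mul_mul_cosh_le hy)) hx
  simp at h
  linarith

theorem ten_mul_cube_add_mul_cosh_le {x : ℝ} (hx : 0 ≤ x) :
    (10 * x ^ 3 + 105 * x) * Real.cosh x ≤
      (x ^ 4 + 45 * x ^ 2 + 105) * Real.sinh x := by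
  have h := eval_mul_cosh_sub_eval_mul_sinh_nonneg (-(10 * X ^ 3 + 105 * X)) (-(X ^ 4 + 45 * X ^ 2 + 105))
    (g := fun y => (y ^ 3 + 15 * y) * Real.cosh y -
      (6 * y ^ 2 + 15) * Real.sinh y)
    (by simp) (fun y => by simp; ring) (fun y hy => sub_nonneg.2 (six_mul_sq_add_mul_sinh_le hy)) hx
  simp at h
  linarith

theorem fifteen_mul_pow_four_add_mul_sinh_le {x : ℝ} (hx : 0 ≤ x) :
    (15 * x ^ 4 + 420 * x ^ 2 + 945) * Real.sinh x ≤
      (x ^ 5 + 105 * x ^ 3 + 945 * x) * Real.cosh x := by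
  have h := eval_mul_cosh_sub_eval_mul_sinh_nonneg (X ^ 5 + 105 * X ^ 3 + 945 * X) (15 * X ^ 4 + 420 * X ^ 2 + 945)
    (g := fun y => (y ^ 4 + 45 * y ^ 2 + 105) * Real.sinh y -
      (10 * y ^ 3 + 105 * y) * Real.cosh y)
    (by simp) (fun y => by simp; ring) (fun y hy => sub_nonneg.2 (ten_mul_cube_add_mul_cosh_le hy)) hx
  simp at h
  linarith

end

/-- For every `Pe > 0`,
`Pe * coth Pe - 1 ≥ 14 (4 Pe⁴ + 90 Pe²) / (4 Pe⁴ + 420 Pe² + 3780)`;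
equivalently, the numerical diffusivity
`Γ̄₅ = 14 Γ (4 Pe⁴ + 90 Pe²) / (4 Pe⁴ + 420 Pe² + 3780)` of the condensed
quintic (p = 5) finite element scheme never exceeds the nodally exact
artificial diffusivity `Γ̄ = Γ (Pe coth Pe - 1)`. -/
theorem p5_scheme_under_diffusive :
    ∀ Pe : ℝ, 0 < Pe →
      14 * (4 * Pe ^ 4 + 90 * Pe ^ 2) / (4 * Pe ^ 4 + 420 * Pe ^ 2 + 3780) ≤
        Pe * (Real.cosh Pe / Real.sinh Pe) - 1 ∧
      ∀ Γ : ℝ, 0 < Γ →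
        14 * Γ * (4 * Pe ^ 4 + 90 * Pe ^ 2) /
            (4 * Pe ^ 4 + 420 * Pe ^ 2 + 3780) ≤
          Γ * (Pe * (Real.cosh Pe / Real.sinh Pe) - 1) := by
  intro x hx
  have hs : 0 < Real.sinh x := Real.sinh_pos_iff.2 hx
  have key : 14 * (4 * x ^ 4 + 90 * x ^ 2) / (4 * x ^ 4 + 420 * x ^ 2 + 3780) ≤
      x * (Real.cosh x / Real.sinh x) - 1 := by
    have h := fifteen_mul_pow_four_add_mul_sinh_le hx.le
    rw [← mul_div_assoc, div_sub_one hs.ne', div_le_div_iff₀ (by positivity) hs]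
    linarith
  refine ⟨key, fun Γ hΓ => ?_⟩
  calc 14 * Γ * (4 * x ^ 4 + 90 * x ^ 2) / (4 * x ^ 4 + 420 * x ^ 2 + 3780)
      = Γ * (14 * (4 * x ^ 4 + 90 * x ^ 2) / (4 * x ^ 4 + 420 * x ^ 2 + 3780)) := by ring
    _ ≤ _ := mul_le_mul_of_nonneg_left key hΓ.le
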